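/- Suppose v : ℝⁿ → ℝ is a convex function with v ≥ 0, v(0) = 0, and such that the Monge–Ampère measure of v satisfies det(∇²v) ≥ λ > 0 on the sublevel set {v ≤ 1}. Then there is a constant C = C(n) depending only on n with Vol({v ≤ 1}) ≤ C λ^{-1/2}. -/

import Mathlib

open MeasureTheory

namespace Stmt4Aux

abbrev E (n : ℕ) := EuclideanSpace ℝ (Fin n)

lemma subgrad {n : ℕ} {v : E n → ℝ} (hd : Differentiable ℝ v) (hc : ConvexOn ℝ Set.univ v)
    (x y : E n) : v x + fderiv ℝ v x (y - x) ≤ v y := by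
  have h1 : ConvexOn ℝ Set.univ (fun t : ℝ => v (AffineMap.lineMap x y t)) := by
    exact hc.comp_affineMap (AffineMap.lineMap x y : ℝ →ᵃ[ℝ] E n)
  have h2 : HasDerivAt (fun t : ℝ => v (AffineMap.lineMap x y t)) (fderiv ℝ v x (y - x)) 0 := by
    have h3 : HasFDerivAt v (fderiv ℝ v x) (AffineMap.lineMap x y (0 : ℝ)) := by
      simpa using (hd x).hasFDerivAt
    exact h3.comp_hasDerivAt (0 : ℝ) AffineMap.hasDerivAt_lineMap
  have := h1.le_slope_of_hasDerivAt (Set.mem_univ (0 : ℝ)) (Set.mem_univ (1 : ℝ)) one_pos h2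
  simp [slope_def_field] at this
  rw [map_sub]
  linarith

lemma grad_inj {n : ℕ} {v : E n → ℝ} (hd : Differentiable ℝ v) (hc : StrictConvexOn ℝ Set.univ v)
    {x y : E n} (h : fderiv ℝ v x = fderiv ℝ v y) : x = y := by
  by_contra hne
  have h1 := subgrad hd hc.convexOn x y
  have h2 := subgrad hd hc.convexOn y x
  have h3 := subgrad hd hc.convexOn x ((1/2 : ℝ) • x + (1/2 : ℝ) • y)
  have h4 := hc.2 (Set.mem_univ x) (Set.mem_univ y) hne
    (show (0 : ℝ) < 1/2 by norm_num) (show (0 : ℝ) < 1/2 by norm_num) (by norm_num)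
  have e : (1/2 : ℝ) • x + (1/2 : ℝ) • y - x = (1/2 : ℝ) • (y - x) := by module
  have e2 : x - y = - (y - x) := by abel
  rw [e, map_smul] at h3
  rw [← h, e2, map_neg] at h2
  simp only [smul_eq_mul] at h3 h4
  linarith

lemma isCompact_sub {n : ℕ} {v : E n → ℝ} (hv : Continuous v)
    (hc : StrictConvexOn ℝ Set.univ v) (h0 : ∀ x, 0 ≤ v x) (hz : v 0 = 0) :
    IsCompact {x | v x ≤ 1} := by
  have hpos : ∀ x ∈ Metric.sphere (0 : E n) 1, 0 < v x := by
    intro x hx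
    have hx0 : x ≠ 0 := by
      rintro rfl
      simp at hx
    have h4 := hc.2 (Set.mem_univ x) (Set.mem_univ 0) hx0
      (show (0 : ℝ) < 1/2 by norm_num) (show (0 : ℝ) < 1/2 by norm_num) (by norm_num)
    have := h0 ((1/2 : ℝ) • x + (1/2 : ℝ) • 0)
    simp only [smul_eq_mul, hz] at h4
    linarith
  obtain ⟨m, hm, hmv⟩ := (isCompact_sphere (0 : E n) 1).exists_forall_le' hv.continuousOn hpos
  apply Metric.isCompact_of_isClosed_isBounded (isClosed_le hv continuous_const)
  refine (Metric.isBounded_closedBall (x := (0 : E n)) (r := max 1 (1/m))).subset ?_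
  intro x hx
  rw [mem_closedBall_zero_iff, le_max_iff]
  by_cases h : ‖x‖ ≤ 1
  · exact Or.inl h
  right
  push Not at h
  have hp : 0 < ‖x‖ := by linarith
  have h1 := hmv (‖x‖⁻¹ • x) (by simp [norm_smul, hp.ne'])
  have h2 := hc.convexOn.2 (Set.mem_univ x) (Set.mem_univ 0) 
    (show 0 ≤ ‖x‖⁻¹ by positivity) (show 0 ≤ 1 - ‖x‖⁻¹ by linarith [inv_le_one_of_one_le₀ h.le]) (by ring)
  simp only [smul_zero, add_zero, hz, smul_eq_mul, mul_zero] at h2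
  have hx' : v x ≤ 1 := hx
  have h3 : m ≤ ‖x‖⁻¹ := by
    have : ‖x‖⁻¹ * v x ≤ ‖x‖⁻¹ * 1 := by gcongr
    linarith
  rw [le_div_iff₀ hm]
  calc ‖x‖ * m ≤ ‖x‖ * ‖x‖⁻¹ := by gcongr
    _ = 1 := mul_inv_cancel₀ hp.ne'

/-- matrix with rows `a j` -/
def R {n : ℕ} (a : Fin n → E n) : Matrix (Fin n) (Fin n) ℝ := Matrix.of fun j i => a j i

lemma exists_max {n : ℕ} {K : Set (E n)} (hK : IsCompact K) (h0 : K ∈ nhds (0 : E n)) :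
    ∃ a : Fin n → E n, (∀ i, a i ∈ K) ∧ (R a).det ≠ 0 ∧
      ∀ b : Fin n → E n, (∀ i, b i ∈ K) → |(R b).det| ≤ |(R a).det| := by
  have hcomp : IsCompact (Set.pi Set.univ (fun _ : Fin n => K)) := isCompact_univ_pi fun _ => hK
  have hcont : Continuous fun a : Fin n → E n => |(R a).det| := by
    apply Continuous.abs
    apply Continuous.matrix_det
    unfold R
    refine continuous_matrix fun i j => ?_
    simp only [Matrix.of_apply]
    fun_prop
  obtain ⟨a, ha, hmax⟩ := hcomp.exists_isMaxOn
    ⟨fun _ => 0, fun _ _ => mem_of_mem_nhds h0⟩ hcont.continuousOn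
  have hmax' : ∀ b : Fin n → E n, (∀ i, b i ∈ K) → |(R b).det| ≤ |(R a).det| :=
    fun b hb => hmax (fun i _ => hb i)
  refine ⟨a, fun i => ha i trivial, ?_, hmax'⟩
  obtain ⟨ε, hε, hball⟩ := Metric.nhds_basis_closedBall.mem_iff.1 h0
  have h1 := hmax' (fun i => EuclideanSpace.single i ε) (fun i => hball (by
    simp [abs_of_pos hε]))
  have h2 : R (fun i : Fin n => (EuclideanSpace.single i ε : E n)) = Matrix.diagonal fun _ => ε := by
    ext i j
    simp [R, Matrix.diagonal_apply, Pi.single_apply, eq_comm]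
  rw [h2, Matrix.det_diagonal] at h1
  intro h
  rw [h] at h1
  rw [abs_zero, Finset.prod_const] at h1
  exact absurd h1 (not_le.2 (abs_pos.2 (pow_pos hε _).ne'))

lemma det_euclid {n : ℕ} (M : Matrix (Fin n) (Fin n) ℝ) :
    LinearMap.det (Matrix.toEuclideanLin M) = M.det := by
  rw [Matrix.toEuclideanLin_eq_toLin, LinearMap.det_toLin]

lemma norm_le_of_coord {n : ℕ} (x : E n) (r : ℝ) (h : ∀ i, |x i| ≤ r) : ‖x‖ ≤ n * r := by
  have : x = ∑ i, EuclideanSpace.single i (x i) := by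
    ext j
    simp [Pi.single_apply]
  rw [this]
  refine (norm_sum_le _ _).trans ?_
  refine (Finset.sum_le_sum (g := fun _ => r) fun i _ => ?_).trans ?_
  · simpa using h i
  · simp

lemma sub_image {n : ℕ} {K : Set (E n)} {a : Fin n → E n} (ha : ∀ i, a i ∈ K)
    (hdet : (R a).det ≠ 0)
    (hmax : ∀ b : Fin n → E n, (∀ i, b i ∈ K) → |(R b).det| ≤ |(R a).det|) :
    K ⊆ (Matrix.toEuclideanLin (R a).transpose) '' Metric.closedBall 0 (n * 1) := by
  intro y hy
  refine ⟨WithLp.toLp 2 ((R a).det⁻¹ • (R a).transpose.cramer y.ofLp), ?_, ?_⟩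
  · rw [mem_closedBall_zero_iff]
    apply norm_le_of_coord
    intro i
    have h1 := hmax (Function.update a i y) (fun j => by
      by_cases h : j = i
      · subst h; simpa using hy
      · simpa [h] using ha j)
    have h2 : R (Function.update a i y) = (R a).updateRow i y.ofLp := by
      ext j k
      by_cases h : j = i
      · subst h; simp [R]
      · simp [R, h]
    rw [h2, ← Matrix.cramer_transpose_apply] at h1
    simp only [Pi.smul_apply, smul_eq_mul, abs_mul, abs_inv]
    rw [inv_mul_le_iff₀ (abs_pos.2 hdet)]
    simpa using h1
  · rw [Matrix.toEuclideanLin_apply]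
    simp only [Matrix.mulVec_smul, Matrix.mulVec_cramer, Matrix.det_transpose, smul_smul,
      inv_mul_cancel₀ hdet, one_smul]

/-- the gradient -/
noncomputable def grad {n : ℕ} (v : E n → ℝ) (x : E n) : E n :=
  WithLp.toLp 2 fun i => fderiv ℝ v x (EuclideanSpace.single i 1)

lemma grad_pair {n : ℕ} (v : E n → ℝ) (x a : E n) :
    ∑ i, a i * grad v x i = fderiv ℝ v x a := by
  have : a = ∑ i, a i • EuclideanSpace.single i (1 : ℝ) := by
    ext j
    simp [Pi.single_apply]
  conv_rhs => rw [this]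
  simp [grad, map_sum]

/-- the Hessian matrix -/
noncomputable def hess {n : ℕ} (v : E n → ℝ) (x : E n) : Matrix (Fin n) (Fin n) ℝ :=
  Matrix.of fun i j : Fin n => iteratedFDeriv ℝ 2 v x
              ![EuclideanSpace.single i (1 : ℝ), EuclideanSpace.single j (1 : ℝ)]

lemma hasFDerivAt_grad {n : ℕ} {v : E n → ℝ} (hv : ContDiff ℝ 2 v) (x : E n) :
    HasFDerivAt (grad v) (LinearMap.toContinuousLinearMap
      (Matrix.toEuclideanLin (hess v x).transpose)) x := by
  rw [← hasFDerivWithinAt_univ, hasFDerivWithinAt_euclidean]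
  intro i
  rw [hasFDerivWithinAt_univ]
  have h1 : HasFDerivAt (fderiv ℝ v) (fderiv ℝ (fderiv ℝ v) x) x :=
    ((hv.fderiv_right (m := 1) (by norm_num)).differentiable (by norm_num) x).hasFDerivAt
  have h2 := h1.clm_apply (hasFDerivAt_const (EuclideanSpace.single i (1 : ℝ)) x)
  refine h2.congr_fderiv ?_
  ext a
  have : a = ∑ i, a i • EuclideanSpace.single i (1 : ℝ) := by
    ext j
    simp [Pi.single_apply]
  conv_lhs => rw [this]
  simp [hess, Matrix.mulVec, dotProduct, iteratedFDeriv_two_apply, map_sum, mul_comm]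

lemma key {n : ℕ} {v : E n → ℝ} {lam : ℝ} (hlam : 0 < lam) (hv : ContDiff ℝ 2 v)
    (hc : StrictConvexOn ℝ Set.univ v) (h0 : ∀ x, 0 ≤ v x) (hz : v 0 = 0)
    (hdet : ∀ x, v x ≤ 1 → lam ≤ (hess v x).det) :
    ∃ d : ℝ, 0 < d ∧
      volume {x | v x ≤ 1} ≤
        ENNReal.ofReal d * volume (Metric.closedBall (0 : E n) (n * 1)) ∧
      ENNReal.ofReal lam * (ENNReal.ofReal ((1/2)^n) * volume {x | v x ≤ 1}) ≤
        ENNReal.ofReal d⁻¹ * volume (Metric.closedBall (0 : E n) (n * (2 * n + 2))) := by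
  set K := {x | v x ≤ 1} with hKdef
  have hd : Differentiable ℝ v := hv.differentiable (by norm_num)
  have hK : IsCompact K := isCompact_sub hv.continuous hc h0 hz
  have hKc : Convex ℝ K := by simpa using hc.convexOn.convex_le 1
  have hK0 : K ∈ nhds (0 : E n) :=
    hv.continuous.continuousAt.eventually (Iic_mem_nhds (by rw [hz]; norm_num))
  obtain ⟨a, ha, had, hmax⟩ := exists_max hK hK0
  refine ⟨|(R a).det|, abs_pos.2 had, ?_, ?_⟩
  · refine (measure_mono (sub_image ha had hmax)).trans ?_
    rw [Measure.addHaar_image_linearMap, det_euclid, Matrix.det_transpose]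
  have hn : (0 : ℝ) < n + 1 := by positivity
  set c : E n := ((n : ℝ) + 1)⁻¹ • ∑ i, a i with hcdef
  have hcK : c ∈ K := by
    have h00 : (0 : E n) ∈ K := mem_of_mem_nhds hK0
    rcases Nat.eq_zero_or_pos n with rfl | hnpos
    · simpa [hcdef] using h00
    · have hn' : (0 : ℝ) < n := by exact_mod_cast hnpos
      have h1 : ∑ i, (n : ℝ)⁻¹ • a i ∈ K :=
        hKc.sum_mem (fun _ _ => by positivity) (by simp [hn'.ne']) (fun i _ => ha i)
      have h2 := hKc h1 h00 (a := n / (n + 1)) (b := 1 / (n + 1)) (by positivity) (by positivity)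
        (by field_simp)
      convert h2 using 1
      rw [hcdef, ← Finset.smul_sum, smul_smul, smul_zero, add_zero]
      congr 1
      field_simp
  have hcsum : ∑ i, a i = ((n : ℝ) + 1) • c := by
    rw [hcdef, smul_smul, mul_inv_cancel₀ hn.ne', one_smul]
  set S := AffineMap.homothety c (1/2 : ℝ) '' K with hS
  have hSK : ∀ x ∈ S, v x ≤ 1 := by
    rintro _ ⟨z, hz, rfl⟩
    have := hKc hz hcK (a := 1/2) (b := 1/2) (by norm_num) (by norm_num) (by norm_num)
    have e : AffineMap.homothety c (1/2 : ℝ) z = (1/2 : ℝ) • z + (1/2 : ℝ) • c := by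
      simp [AffineMap.homothety_apply]; module
    rw [e]
    exact this
  have hSm : MeasurableSet S :=
    (hK.image (AffineMap.homothety_continuous c (1/2 : ℝ))).isClosed.measurableSet
  have hinj : Set.InjOn (grad v) S := by
    intro x _ y _ hxy
    apply grad_inj hd hc
    ext z
    rw [← grad_pair, ← grad_pair, hxy]
  have hJ := lintegral_abs_det_fderiv_eq_addHaar_image volume hSm
    (fun x _ => (hasFDerivAt_grad hv x).hasFDerivWithinAt) hinj
  have hL : ENNReal.ofReal lam * volume S ≤ volume (grad v '' S) := by
    rw [← hJ, ← setLIntegral_const]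
    refine setLIntegral_mono' hSm fun x hx => ENNReal.ofReal_le_ofReal ?_
    have h1 := hdet x (hSK x hx)
    have h2 : (LinearMap.toContinuousLinearMap
      (Matrix.toEuclideanLin (hess v x).transpose)).det = (hess v x).det := by
      rw [LinearMap.det_toContinuousLinearMap, det_euclid, Matrix.det_transpose]
    rw [h2]
    exact h1.trans (le_abs_self _)
  have hvS : volume S = ENNReal.ofReal ((1/2)^n) * volume K := by
    rw [hS, Measure.addHaar_image_homothety, abs_of_nonneg (by positivity)]
    simp
  rw [← hvS]
  refine hL.trans ?_
  have hsub : grad v '' S ⊆ (Matrix.toEuclideanLin (R a)) ⁻¹'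
      Metric.closedBall 0 (n * (2 * n + 2)) := by
    rintro _ ⟨x, hx, rfl⟩
    rw [Set.mem_preimage, mem_closedBall_zero_iff]
    apply norm_le_of_coord
    intro i
    have e1 : (Matrix.toEuclideanLin (R a) (grad v x)) i = fderiv ℝ v x (a i) := by
      rw [← grad_pair]
      simp [R, Matrix.mulVec, dotProduct]
    rw [e1]
    set p := fderiv ℝ v x with hp
    have hb : ∀ y ∈ K, p y - p c ≤ 2 := by
      intro y hy
      have h1 := subgrad hd hc.convexOn x y
      obtain ⟨z, hz, hzx⟩ := hx
      have h2 := subgrad hd hc.convexOn x z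
      have e : x = (1/2 : ℝ) • z + (1/2 : ℝ) • c := by
        rw [← hzx]
        simp [AffineMap.homothety_apply]; module
      have e3 : p x = 1/2 * p z + 1/2 * p c := by
        conv_lhs => rw [e]
        simp
      rw [← hp, map_sub] at h1 h2
      have hy' : v y ≤ 1 := hy
      have hz' : v z ≤ 1 := hz
      have := h0 x
      linarith
    have hs : ∑ j, (p (a j) - p c) = p c := by
      rw [Finset.sum_sub_distrib, ← map_sum, hcsum]
      simp; ring
    have hlow := hb 0 (mem_of_mem_nhds hK0)
    rw [map_zero] at hlow
    have hi := hb (a i) (ha i)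
    have hup : p c ≤ 2 * n := by
      rw [← hs]
      refine (Finset.sum_le_sum (g := fun _ => (2 : ℝ)) fun j _ => hb _ (ha j)).trans ?_
      simp; linarith
    have hai : p c - p (a i) ≤ 2 * n - (p c + p (a i) - p (a i)) + p c := by
      have h1 : ∑ j ∈ Finset.univ.erase i, (p (a j) - p c) ≤ 2 * (n - 1) := by
        refine (Finset.sum_le_sum (g := fun _ => (2 : ℝ)) fun j _ => hb _ (ha j)).trans ?_
        have : 1 ≤ n := i.pos
        simp [Nat.cast_sub this]; linarith
      have h2 := Finset.add_sum_erase Finset.univ (fun j => p (a j) - p c) (Finset.mem_univ i)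
      simp only [hs] at h2
      linarith
    rw [abs_le]
    constructor <;> linarith
  refine (measure_mono hsub).trans ?_
  rw [Measure.addHaar_preimage_linearMap _ (by rwa [det_euclid]), det_euclid, abs_inv]

end Stmt4Aux

open Stmt4Aux in
theorem stmt4 (n : ℕ) :
    ∃ C : ℝ, 0 < C ∧
      ∀ (v : EuclideanSpace ℝ (Fin n) → ℝ) (lam : ℝ), 0 < lam →
        ContDiff ℝ 2 v → StrictConvexOn ℝ Set.univ v →
        (∀ x, 0 ≤ v x) → v 0 = 0 →
        (∀ x, v x ≤ 1 → lam ≤ (Matrix.of fun i j : Fin n =>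
            iteratedFDeriv ℝ 2 v x
              ![EuclideanSpace.single i (1 : ℝ), EuclideanSpace.single j (1 : ℝ)]).det) →
        (volume {x | v x ≤ 1}).toReal ≤ C * lam ^ (-(1 : ℝ)/2) := by
  set β := (volume (Metric.closedBall (0 : E n) (n * 1))).toReal with hβ
  set γ := (volume (Metric.closedBall (0 : E n) (n * (2 * n + 2)))).toReal with hγ
  have hβ0 : 0 ≤ β := ENNReal.toReal_nonneg
  have hγ0 : 0 ≤ γ := ENNReal.toReal_nonneg
  refine ⟨√(2 ^ n * γ * β) + 1, by positivity, ?_⟩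
  intro v lam hlam hv hc h0 hz hdet
  obtain ⟨d, hd, h1, h2⟩ := key hlam hv hc h0 hz hdet
  have fin1 : volume (Metric.closedBall (0 : E n) (n * 1)) ≠ ⊤ := measure_closedBall_lt_top.ne
  have fin2 : volume (Metric.closedBall (0 : E n) (n * (2 * n + 2))) ≠ ⊤ :=
    measure_closedBall_lt_top.ne
  have h1' := ENNReal.toReal_mono (ENNReal.mul_ne_top ENNReal.ofReal_ne_top fin1) h1
  have h2' := ENNReal.toReal_mono (ENNReal.mul_ne_top ENNReal.ofReal_ne_top fin2) h2
  simp only [ENNReal.toReal_mul] at h1' h2'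
  rw [ENNReal.toReal_ofReal hd.le, ← hβ] at h1'
  rw [ENNReal.toReal_ofReal hlam.le, ENNReal.toReal_ofReal (by positivity),
    ENNReal.toReal_ofReal (by positivity), ← hγ] at h2'
  set V := (volume {x | v x ≤ 1}).toReal with hV
  have hV0 : 0 ≤ V := ENNReal.toReal_nonneg
  have h3 : lam * V ^ 2 ≤ 2 ^ n * γ * β := by
    have e1 : lam * V ≤ 2 ^ n * (d⁻¹ * γ) := by
      calc lam * V = 2 ^ n * (lam * ((1/2) ^ n * V)) := by
            rw [one_div, inv_pow]; field_simp
        _ ≤ _ := by gcongr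
    calc lam * V ^ 2 = (lam * V) * V := by ring
      _ ≤ (2 ^ n * (d⁻¹ * γ)) * (d * β) := by gcongr
      _ = 2 ^ n * γ * β := by field_simp
  have h4 : √lam * V ≤ √(2 ^ n * γ * β) := by
    apply Real.le_sqrt_of_sq_le
    rw [mul_pow, Real.sq_sqrt hlam.le]
    exact h3
  have hs : 0 < √lam := Real.sqrt_pos.2 hlam
  have e : lam ^ (-(1 : ℝ)/2) = (√lam)⁻¹ := by
    rw [neg_div, Real.rpow_neg hlam.le, Real.sqrt_eq_rpow]
  rw [e, ← div_eq_mul_inv, le_div_iff₀ hs]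
  linarith
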